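/- Conjugation formula for nonsymmetric Macdonald polynomials: let * be the ℚ-algebra automorphism of L determined by u ↦ u^{-1}, v ↦ v^{-1}, X ↦ X^{-1}. Then for every m ∈ ℤ: (E_m)* = X^{-1}·E_{1−m} = q^{-m/2}·π(E_m); moreover (E_m)* = t^{1/2}·T(E_m) if m > 0 and (E_m)* = t^{-1/2}·T(E_m) if m ≤ 0 (the sign convention being sgn(0) = −1). -/

import Mathlib

/-!
Nonsymmetric Macdonald polynomials of type A₁: the explicit Laurent polynomials `E n`
are eigenfunctions of the Dunkl-type operator `Y` with eigenvalue `q^{-n_#}`.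

The ground field is `F = ℚ(u,v)` with `q = u⁴`, `t = v²`; the Laurent polynomials
`F[X, X⁻¹]` are regarded inside the ambient field `M = F(X)`, in which all operators
are given by the same formulas (division by `X² - 1` is then unproblematic).
-/

noncomputable section

/-- The ground field `ℚ(u,v)`. -/
abbrev F : Type := RatFunc (RatFunc ℚ)

/-- `u`, with `q = u⁴` (so `u = q^{1/4}`). -/
def u : F := RatFunc.C RatFunc.X

/-- `v`, with `t = v²` (so `v = t^{1/2}`). -/
def v : F := RatFunc.X

/-- `q = u⁴`. -/
def q : F := u ^ 4

/-- `t = v²`. -/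
def t : F := v ^ 2

/-- The ambient field `F(X)` containing the Laurent polynomials `F[X,X⁻¹]`. -/
abbrev M : Type := RatFunc F

/-- The variable `X`. -/
def XM : M := RatFunc.X

/-- The involution `s : Xⁿ ↦ X⁻ⁿ` (the substitution `X ↦ X⁻¹`). -/
def sOp : M → M := RatFunc.eval RatFunc.C (XM⁻¹)

/-- The operator `π : Xⁿ ↦ q^{n/2} X⁻ⁿ` (the substitution `X ↦ q^{1/2} X⁻¹`). -/
def piOp : M → M := RatFunc.eval RatFunc.C (RatFunc.C (u ^ 2) * XM⁻¹)

/-- The Demazure-Lusztig operator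
`T(f) = t^{1/2}·s(f) + (t^{1/2} - t^{-1/2})·(s(f) - f)/(X² - 1)`. -/
def TOp (f : M) : M :=
  RatFunc.C v * sOp f + RatFunc.C (v - v⁻¹) * (sOp f - f) / (XM ^ 2 - 1)

/-- The operator `Y = π ∘ T`. -/
def YOp (f : M) : M := piOp (TOp f)

/-- The product `∏_{i=0}^{j-1} [(1-q^{n-i-1})(1-t qⁱ)]/[(1-q^{1+i})(1-t q^{n-i-1})]`. -/
def macProdPos (n j : ℕ) : F :=
  ∏ i ∈ Finset.range j,
    ((1 - q ^ ((n : ℤ) - i - 1)) * (1 - t * q ^ (i : ℤ))) /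
      ((1 - q ^ ((i : ℤ) + 1)) * (1 - t * q ^ ((n : ℤ) - i - 1)))

/-- The product `∏_{i=0}^{j-1} [(1-q^{n-i})(1-t qⁱ)]/[(1-q^{1+i})(1-t q^{n-i})]`. -/
def macProdNeg (n j : ℕ) : F :=
  ∏ i ∈ Finset.range j,
    ((1 - q ^ ((n : ℤ) - i)) * (1 - t * q ^ (i : ℤ))) /
      ((1 - q ^ ((i : ℤ) + 1)) * (1 - t * q ^ ((n : ℤ) - i)))

/-- `E_n` for `n ≥ 1`. -/
def Epos (n : ℕ) : M :=
  XM ^ (n : ℤ)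
    + ∑ j ∈ Finset.Icc 1 (n / 2),
        RatFunc.C (q ^ ((n : ℤ) - j) * (1 - q ^ (j : ℤ)) / (1 - q ^ ((n : ℤ) - j)) *
          macProdPos n j) * XM ^ (2 * (j : ℤ) - n)
    + ∑ j ∈ Finset.Icc 1 ((n - 1) / 2),
        RatFunc.C (q ^ (j : ℤ) * macProdPos n j) * XM ^ ((n : ℤ) - 2 * j)

/-- `E_{-n}` for `n ≥ 1`. -/
def Eneg (n : ℕ) : M :=
  XM ^ (-(n : ℤ))
    + RatFunc.C ((1 - t) / (1 - t * q ^ (n : ℤ))) * XM ^ (n : ℤ)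
    + ∑ j ∈ Finset.Icc 1 (n / 2),
        RatFunc.C (macProdNeg n j) * XM ^ (2 * (j : ℤ) - n)
    + ∑ j ∈ Finset.Icc 1 ((n - 1) / 2),
        RatFunc.C ((1 - t * q ^ (j : ℤ)) / (1 - t * q ^ ((n : ℤ) - j)) * macProdNeg n j) *
          XM ^ ((n : ℤ) - 2 * j)

/-- The nonsymmetric Macdonald polynomials `E_n`, `n ∈ ℤ`, given by the explicit formulas. -/
def E : ℤ → M := fun n => if 0 < n then Epos n.toNat else if n = 0 then 1 else Eneg (-n).toNat

/-- Given a (coefficient) conjugation `σ` of the field `K`, the conjugation of `RatFunc K`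
acting by `σ` on coefficients and inverting the variable.  When `σ` is a field
endomorphism this is the unique extension of `σ` with `X ↦ X⁻¹`: it sends
`num/denom` to `σ(num)(X⁻¹)/σ(denom)(X⁻¹)`. -/
def ratConj {K : Type} [Field K] (σ : K → K) (p : RatFunc K) : RatFunc K :=
  (p.num.sum fun i a => RatFunc.C (σ a) * (RatFunc.X : RatFunc K)⁻¹ ^ i) /
    (p.denom.sum fun i a => RatFunc.C (σ a) * (RatFunc.X : RatFunc K)⁻¹ ^ i)

/-- The automorphism of `ℚ(u)` determined by `u ↦ u⁻¹`. -/
def conjU : RatFunc ℚ → RatFunc ℚ := ratConj id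

/-- The automorphism of `F = ℚ(u,v)` determined by `u ↦ u⁻¹`, `v ↦ v⁻¹`. -/
def conjF : F → F := ratConj conjU

/-- The `ℚ`-algebra automorphism `*` of `L` determined by
`u ↦ u⁻¹`, `v ↦ v⁻¹`, `X ↦ X⁻¹`. -/
def starM : M → M := ratConj conjF

lemma subst_transcendental {K : Type} [Field K] (c : K) (hc : c ≠ 0) :
    Transcendental K (RatFunc.C c * (RatFunc.X : RatFunc K)⁻¹) := by
  apply RatFunc.transcendental_of_ne_C
  rintro ⟨d, hd⟩
  have h := congrArg RatFunc.intDegree hd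
  rw [RatFunc.intDegree_mul (by simpa using hc) (by simp [RatFunc.X_ne_zero]),
    RatFunc.intDegree_inv] at h
  simp at h

lemma exHom {K : Type} [Field K] (σ : K →+* K) (c : K) (hc : c ≠ 0) :
    ∃ Φ : RatFunc K →+* RatFunc K,
      (∀ f, Φ f = Polynomial.eval₂ (RatFunc.C.comp σ) (RatFunc.C c * (RatFunc.X : RatFunc K)⁻¹) f.num
        / Polynomial.eval₂ (RatFunc.C.comp σ) (RatFunc.C c * (RatFunc.X : RatFunc K)⁻¹) f.denom) ∧
      Φ RatFunc.X = RatFunc.C c * (RatFunc.X : RatFunc K)⁻¹ ∧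
      ∀ a, Φ (RatFunc.C a) = RatFunc.C (σ a) := by
  set a := RatFunc.C c * (RatFunc.X : RatFunc K)⁻¹ with ha
  have htr : Transcendental K a := subst_transcendental c hc
  have hinj : Function.Injective (Polynomial.eval₂RingHom (RatFunc.C.comp σ) a) := by
    rw [injective_iff_map_eq_zero]
    intro p hp
    rw [Polynomial.coe_eval₂RingHom, ← Polynomial.eval₂_map] at hp
    rw [transcendental_iff] at htr
    have h2 := htr (p.map σ) (by
      rw [Polynomial.aeval_def]
      exact hp)
    exact (Polynomial.map_eq_zero σ).1 h2
  have hle := nonZeroDivisors_le_comap_nonZeroDivisors_of_injective _ hinj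
  refine ⟨RatFunc.liftRingHom _ hle, ?_, ?_, ?_⟩
  · intro f
    rw [RatFunc.liftRingHom_apply]
    rfl
  · rw [RatFunc.liftRingHom_X]
    simp
  · intro x
    rw [RatFunc.liftRingHom_C]
    simp

lemma ratConj_hom {K : Type} [Field K] (σ : K →+* K) :
    ∃ Φ : RatFunc K →+* RatFunc K, (∀ f, Φ f = ratConj σ f) ∧
      Φ RatFunc.X = (RatFunc.X : RatFunc K)⁻¹ ∧ ∀ a, Φ (RatFunc.C a) = RatFunc.C (σ a) := by
  obtain ⟨Φ, h1, h2, h3⟩ := exHom σ 1 one_ne_zero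
  refine ⟨Φ, ?_, by simpa using h2, h3⟩
  intro f
  rw [h1, ratConj, Polynomial.eval₂_eq_sum, Polynomial.eval₂_eq_sum]
  simp

lemma star_hom : ∃ σ : F →+* F, σ u = u⁻¹ ∧ σ v = v⁻¹ ∧
    ∃ S : M →+* M, (∀ f, S f = starM f) ∧ S XM = XM⁻¹ ∧
      ∀ a, S (RatFunc.C a) = RatFunc.C (σ a) := by
  obtain ⟨α, a1, a2, a3⟩ := ratConj_hom (RingHom.id ℚ)
  have ha : (α : RatFunc ℚ → RatFunc ℚ) = conjU := by
    funext f; rw [a1]; rfl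
  obtain ⟨β, b1, b2, b3⟩ := ratConj_hom α
  have hb : (β : F → F) = conjF := by
    funext f; rw [b1, ha]; rfl
  obtain ⟨γ, c1, c2, c3⟩ := ratConj_hom β
  have hc : ∀ f, γ f = starM f := by
    intro f; rw [c1, hb]; rfl
  refine ⟨β, ?_, ?_, γ, hc, c2, c3⟩
  · rw [u, b3, a2, map_inv₀]
  · exact b2

lemma u_ne : u ≠ 0 := by
  rw [u]; simp [RatFunc.X_ne_zero]

lemma v_ne : v ≠ 0 := RatFunc.X_ne_zero

lemma q_ne : q ≠ 0 := pow_ne_zero _ u_ne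

lemma t_ne : t ≠ 0 := pow_ne_zero _ v_ne

lemma XM_ne : XM ≠ 0 := RatFunc.X_ne_zero

lemma s_hom : ∃ S : M →+* M, (∀ f, S f = sOp f) ∧ S XM = XM⁻¹ ∧
      ∀ a, S (RatFunc.C a) = RatFunc.C a := by
  obtain ⟨Φ, h1, h2, h3⟩ := exHom (RingHom.id F) 1 one_ne_zero
  refine ⟨Φ, ?_, by simpa [XM] using h2, h3⟩
  intro f
  rw [h1, sOp, RatFunc.eval]
  simp [XM]

lemma pi_hom : ∃ S : M →+* M, (∀ f, S f = piOp f) ∧ S XM = RatFunc.C (u ^ 2) * XM⁻¹ ∧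
      ∀ a, S (RatFunc.C a) = RatFunc.C a := by
  obtain ⟨Φ, h1, h2, h3⟩ := exHom (RingHom.id F) (u ^ 2) (pow_ne_zero _ u_ne)
  refine ⟨Φ, ?_, h2, h3⟩
  intro f
  rw [h1, piOp, RatFunc.eval]
  simp [XM]

lemma intDegree_X_pow {K : Type} [Field K] (n : ℕ) :
    ((RatFunc.X : RatFunc K) ^ n).intDegree = n := by
  induction n with
  | zero => simp
  | succ n ih =>
    rw [pow_succ, RatFunc.intDegree_mul (pow_ne_zero _ RatFunc.X_ne_zero) RatFunc.X_ne_zero, ih]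
    simp

lemma one_sub_q_ne (k : ℕ) (hk : 0 < k) : (1 : F) - q ^ k ≠ 0 := by
  intro h
  have h1 : (RatFunc.C ((RatFunc.X : RatFunc ℚ) ^ (4 * k)) : F) = RatFunc.C 1 := by
    rw [map_pow, map_one, pow_mul]
    exact (sub_eq_zero.1 h).symm
  have h2 := congrArg RatFunc.intDegree (RingHom.injective (RatFunc.C : RatFunc ℚ →+* F) h1)
  rw [intDegree_X_pow, RatFunc.intDegree_one] at h2
  omega

lemma one_sub_tq_ne (k : ℕ) : (1 : F) - t * q ^ k ≠ 0 := by
  intro h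
  have h1 : t * q ^ k = 1 := (sub_eq_zero.1 h).symm
  have h2 := congrArg RatFunc.intDegree h1
  have h3 : q ^ k = RatFunc.C ((RatFunc.X : RatFunc ℚ) ^ (4 * k)) := by
    rw [map_pow, pow_mul]; rfl
  rw [RatFunc.intDegree_mul t_ne (pow_ne_zero _ q_ne), RatFunc.intDegree_one, h3,
    RatFunc.intDegree_C, t, v, intDegree_X_pow] at h2
  norm_num at h2

lemma sub_one_ne : XM ^ 2 - 1 ≠ 0 := by
  intro h
  have h2 := congrArg RatFunc.intDegree (sub_eq_zero.1 h)
  rw [XM, intDegree_X_pow, RatFunc.intDegree_one] at h2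
  norm_num at h2

/-- recurrence -/
lemma P_succ (N j k : ℕ) (h : j + k = N) :
    macProdNeg N (j + 1) * ((1 - q ^ (j + 1)) * (1 - t * q ^ k)) =
      macProdNeg N j * ((1 - q ^ k) * (1 - t * q ^ j)) := by
  have e : (N : ℤ) - j = (k : ℕ) := by omega
  have e' : (j : ℤ) + 1 = ((j + 1 : ℕ) : ℤ) := by push_cast; ring
  rw [macProdNeg, Finset.prod_range_succ, ← macProdNeg, e, e']
  simp only [zpow_natCast]
  have h1 := one_sub_q_ne (j + 1) (by omega)
  have h2 := one_sub_tq_ne k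
  rw [mul_assoc, div_mul_cancel₀ _ (mul_ne_zero h1 h2)]

def fq (n : ℕ) : F := ∏ i ∈ Finset.range n, (1 - q ^ (i + 1))
def gq (n : ℕ) : F := ∏ i ∈ Finset.range n, (1 - t * q ^ i)

lemma fq_ne (n : ℕ) : fq n ≠ 0 :=
  Finset.prod_ne_zero_iff.2 fun i _ => one_sub_q_ne (i + 1) (by omega)
lemma gq_ne (n : ℕ) : gq n ≠ 0 :=
  Finset.prod_ne_zero_iff.2 fun i _ => one_sub_tq_ne i
lemma fq_succ (n : ℕ) : fq (n + 1) = fq n * (1 - q ^ (n + 1)) := Finset.prod_range_succ _ _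
lemma gq_succ (n : ℕ) : gq (n + 1) = gq n * (1 - t * q ^ n) := Finset.prod_range_succ _ _

lemma P_closed (N a : ℕ) : ∀ b, a + b = N →
    macProdNeg N a * (fq a * fq b * gq (N + 1)) = fq N * gq a * gq (b + 1) := by
  induction a with
  | zero =>
    intro b h
    have : b = N := by omega
    subst this
    simp [macProdNeg, fq, gq]
  | succ a ih =>
    intro b h
    have h1 := ih (b + 1) (by omega)
    have h2 := P_succ N a (b + 1) (by omega)
    have n1 := one_sub_tq_ne (b + 1)
    have n2 := one_sub_q_ne (b + 1) (by omega)
    rw [fq_succ b, gq_succ (b + 1)] at h1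
    rw [fq_succ, gq_succ a]
    apply mul_right_cancel₀ n1
    apply mul_right_cancel₀ n2
    linear_combination (fq a * fq b * gq (N + 1)) * (1 - q ^ (b + 1)) * h2 +
      (1 - q ^ (b + 1)) * (1 - t * q ^ a) * h1

lemma P_symm (N a b : ℕ) (h : a + b = N) :
    macProdNeg N b * (1 - t * q ^ b) = macProdNeg N a * (1 - t * q ^ a) := by
  have h1 := P_closed N a b h
  have h2 := P_closed N b a (by omega)
  have n1 := fq_ne a
  have n2 := fq_ne b
  have n3 := gq_ne (N + 1)
  rw [gq_succ b] at h1
  rw [gq_succ a] at h2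
  apply mul_right_cancel₀ (mul_ne_zero (mul_ne_zero n1 n2) n3)
  linear_combination (1 - t * q ^ b) * h2 - (1 - t * q ^ a) * h1

lemma P_end (N : ℕ) : macProdNeg N (N + 1) = 0 := by
  have h := P_succ N N 0 (by omega)
  have h1 := one_sub_q_ne (N + 1) (by omega)
  have h2 := one_sub_tq_ne 0
  have h3 : macProdNeg N (N + 1) * ((1 - q ^ (N + 1)) * (1 - t * q ^ 0)) = 0 := by
    rw [h]; ring
  exact (mul_eq_zero.1 h3).resolve_right (mul_ne_zero h1 h2)

lemma P_conj (σ : F →+* F) (hu : σ u = u⁻¹) (hv : σ v = v⁻¹) (N j : ℕ) (h : j ≤ N + 1) :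
    σ (macProdNeg N j) = q ^ j * macProdNeg N j := by
  have hq : σ q = q⁻¹ := by rw [q, map_pow, hu, inv_pow]
  have ht : σ t = t⁻¹ := by rw [t, map_pow, hv, inv_pow]
  induction j with
  | zero => simp [macProdNeg]
  | succ j ih =>
    obtain ⟨k, hk⟩ : ∃ k, j + k = N := ⟨N - j, by omega⟩
    have h1 := P_succ N j k hk
    have h2 := congrArg σ h1
    have ih := ih (by omega)
    simp only [map_mul, map_sub, map_one, map_pow, hq, ht, ih] at h2
    have n1 := one_sub_q_ne (j + 1) (by omega)
    have n2 := one_sub_tq_ne k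
    have nq := q_ne
    have nt := t_ne
    have e1 : ∀ i : ℕ, (1 : F) - q⁻¹ ^ i = -(1 - q ^ i) / q ^ i := by
      intro i; rw [inv_pow]; field_simp; ring
    have e2 : ∀ i : ℕ, (1 : F) - t⁻¹ * q⁻¹ ^ i = -(1 - t * q ^ i) / (t * q ^ i) := by
      intro i; rw [inv_pow]; field_simp; ring
    rw [e1, e1, e2, e2] at h2
    apply mul_right_cancel₀ (mul_ne_zero n1 n2)
    rw [mul_assoc (q ^ (j + 1)), h1]
    rw [pow_succ] at h2 ⊢
    field_simp at h2 ⊢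
    linear_combination h2

lemma sum_split {A : Type*} [AddCommMonoid A] (n : ℕ) (hn : 1 ≤ n) (G : ℕ → A) :
    ∑ j ∈ Finset.range n, G j = G 0 + ∑ j ∈ Finset.Icc 1 (n / 2), G (n - j) +
      ∑ j ∈ Finset.Icc 1 ((n - 1) / 2), G j := by
  have h1 : ∑ j ∈ Finset.Icc 1 (n / 2), G (n - j) = ∑ j ∈ Finset.Ico (n - n / 2) n, G j := by
    apply Finset.sum_nbij' (fun j => n - j) (fun j => n - j)
    · intro a ha; simp only [Finset.mem_Icc, Finset.mem_Ico] at *; omega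
    · intro a ha; simp only [Finset.mem_Icc, Finset.mem_Ico] at *; omega
    · intro a ha; simp only [Finset.mem_Icc] at *; omega
    · intro a ha; simp only [Finset.mem_Ico] at *; omega
    · intro a ha; rfl
  have h2 : Finset.Icc 1 ((n - 1) / 2) = Finset.Ico 1 (n - n / 2) := by
    ext a; simp only [Finset.mem_Icc, Finset.mem_Ico]; omega
  rw [h1, h2, Finset.range_eq_Ico, Finset.sum_eq_sum_Ico_succ_bot (by omega),
    ← Finset.sum_Ico_consecutive G (show 0 + 1 ≤ n - n / 2 by omega) (by omega)]
  rw [add_assoc, add_comm (∑ j ∈ Finset.Ico (n - n / 2) n, G j)]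

lemma sum_split' {A : Type*} [AddCommMonoid A] (N : ℕ) (hN : 1 ≤ N) (G : ℕ → A) :
    ∑ j ∈ Finset.range (N + 1), G j = G 0 + G N + ∑ j ∈ Finset.Icc 1 (N / 2), G j +
      ∑ j ∈ Finset.Icc 1 ((N - 1) / 2), G (N - j) := by
  rw [← Finset.sum_range_reflect, Finset.sum_range_succ]
  have h : ∀ j, G (N + 1 - 1 - j) = G (N - j) := fun j => by simp
  simp only [h]
  rw [sum_split N hN (fun j => G (N - j))]
  have h2 : ∑ j ∈ Finset.Icc 1 (N / 2), G (N - (N - j)) = ∑ j ∈ Finset.Icc 1 (N / 2), G j := by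
    apply Finset.sum_congr rfl
    intro j hj
    simp only [Finset.mem_Icc] at hj
    congr 1; omega
  simp only [h2, Nat.sub_self, Nat.sub_zero]
  ac_rfl

lemma E_neg_eq (N : ℕ) : E (-(N : ℤ)) =
    ∑ j ∈ Finset.range (N + 1), RatFunc.C (macProdNeg N j) * XM ^ (2 * (j : ℤ) - N) := by
  rcases Nat.eq_zero_or_pos N with rfl | hN
  · simp [E, macProdNeg]
  rw [sum_split' N hN]
  have hE : E (-(N : ℤ)) = Eneg N := by
    have h2 : ¬ (-(N : ℤ) = 0) := by omega
    simp [E, h2]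
  rw [hE, Eneg]
  congr 1
  · congr 1
    congr 1
    · simp [macProdNeg]
    · have h := P_symm N 0 N (by omega)
      have n2 := one_sub_tq_ne N
      have : macProdNeg N N = (1 - t) / (1 - t * q ^ (N : ℤ)) := by
        rw [zpow_natCast, eq_div_iff n2, h]
        simp [macProdNeg]
      rw [this]
      congr 2
      ring
  · apply Finset.sum_congr rfl
    intro j hj
    simp only [Finset.mem_Icc] at hj
    have h := P_symm N j (N - j) (by omega)
    have n2 := one_sub_tq_ne (N - j)
    have e : (N : ℤ) - j = ((N - j : ℕ) : ℤ) := by omega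
    have : macProdNeg N (N - j) =
        (1 - t * q ^ (j : ℤ)) / (1 - t * q ^ ((N : ℤ) - j)) * macProdNeg N j := by
      rw [e, zpow_natCast, zpow_natCast, div_mul_eq_mul_div, eq_div_iff n2, h]
      ring
    rw [this]
    congr 2
    omega

lemma macProdPos_eq (N j : ℕ) : macProdPos (N + 1) j = macProdNeg N j := by
  apply Finset.prod_congr rfl
  intro i _
  have : ((N + 1 : ℕ) : ℤ) - i - 1 = N - i := by push_cast; ring
  rw [this]

lemma P_symm2 (N a b : ℕ) (h : a + b = N) :
    macProdNeg N b * (1 - q ^ b) = macProdNeg N (a + 1) * (1 - q ^ (a + 1)) := by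
  have h1 := P_symm N a b h
  have h2 := P_succ N a b h
  have n2 := one_sub_tq_ne b
  apply mul_right_cancel₀ n2
  linear_combination (1 - q ^ b) * h1 - h2

lemma E_pos_eq (N : ℕ) : E ((N : ℤ) + 1) =
    ∑ j ∈ Finset.range (N + 1),
      RatFunc.C (q ^ j * macProdNeg N j) * XM ^ ((N : ℤ) + 1 - 2 * j) := by
  rw [sum_split (N + 1) (by omega)]
  have hE : E ((N : ℤ) + 1) = Epos (N + 1) := by
    have h1 : (0 < (N : ℤ) + 1) := by omega
    have h2 : ((N : ℤ) + 1).toNat = N + 1 := by omega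
    simp [E, h2]
  rw [hE, Epos]
  simp only [macProdPos_eq]
  congr 1
  · congr 1
    · simp [macProdNeg]
    · apply Finset.sum_congr rfl
      intro j hj
      simp only [Finset.mem_Icc] at hj
      obtain ⟨a, rfl⟩ : ∃ a, j = a + 1 := ⟨j - 1, by omega⟩
      obtain ⟨b, rfl⟩ : ∃ b, N = a + b := ⟨N - a, by omega⟩
      have h := P_symm2 (a + b) a b rfl
      have e : ((a + b + 1 : ℕ) : ℤ) - ((a + 1 : ℕ) : ℤ) = (b : ℕ) := by push_cast; ring
      have e2 : a + b + 1 - (a + 1) = b := by omega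
      have n := one_sub_q_ne b (by omega)
      rw [e, e2]
      have : macProdNeg (a + b) b =
          macProdNeg (a + b) (a + 1) * (1 - q ^ (a + 1)) / (1 - q ^ b) := by
        rw [eq_div_iff n, h]
      rw [this]
      congr 2
      · rw [zpow_natCast, zpow_natCast]
        ring
      · push_cast; ring

lemma gen_zpow_add {K : Type} [Field K] (x : K) (hx : x ≠ 0) (a b : ℤ) (h : a = 2 + b) :
    x ^ a = x ^ 2 * x ^ b := by
  rw [h, zpow_add₀ hx, ← zpow_natCast x 2]; norm_num

lemma T_coef (N j k : ℕ) (h : j + k = N) :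
    (1 - t⁻¹) * (macProdNeg N j - macProdNeg N k) =
      (q ^ (j + 1) - 1) * macProdNeg N (j + 1) - (q ^ j - 1) * macProdNeg N j := by
  have h1 := P_succ N j k h
  have h2 := P_symm N j k h
  have n2 := one_sub_tq_ne k
  have ht : t * t⁻¹ = 1 := mul_inv_cancel₀ t_ne
  apply mul_right_cancel₀ n2
  linear_combination h1 - (1 - t⁻¹) * h2 - macProdNeg N j * (q ^ j - q ^ k) * ht

lemma T_key (N : ℕ) :
    (XM ^ 2 - 1) *
      (∑ j ∈ Finset.range (N + 1), RatFunc.C (q ^ j * macProdNeg N j) * XM ^ ((N : ℤ) - 2 * j)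
        - ∑ j ∈ Finset.range (N + 1), RatFunc.C (macProdNeg N j) * XM ^ ((N : ℤ) - 2 * j)) =
    RatFunc.C (1 - t⁻¹) *
      (∑ j ∈ Finset.range (N + 1), RatFunc.C (macProdNeg N j) * XM ^ ((N : ℤ) - 2 * j)
        - ∑ j ∈ Finset.range (N + 1), RatFunc.C (macProdNeg N j) * XM ^ (2 * (j : ℤ) - N)) := by
  rw [← Finset.sum_range_reflect (fun j : ℕ => RatFunc.C (macProdNeg N j) * XM ^ (2 * (j : ℤ) - N))]
  rw [← Finset.sum_sub_distrib, ← Finset.sum_sub_distrib, Finset.mul_sum, Finset.mul_sum]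
  have tel := Finset.sum_range_sub
    (fun j : ℕ => RatFunc.C ((q ^ j - 1) * macProdNeg N j) * XM ^ ((N : ℤ) + 2 - 2 * j)) (N + 1)
  simp only [P_end, pow_zero, sub_self, zero_mul, mul_zero, map_zero] at tel
  calc _ = ∑ j ∈ Finset.range (N + 1), (_ - _) := Finset.sum_congr rfl ?_
    _ = _ := (Finset.sum_sub_distrib _ _).trans ((congrArg _ tel).trans (sub_zero _))
  intro j hj
  have hj' : j < N + 1 := Finset.mem_range.1 hj
  have X0 := XM_ne
  have e1 : XM ^ ((N : ℤ) + 2 - 2 * ((j + 1 : ℕ) : ℤ)) = XM ^ ((N : ℤ) - 2 * j) := by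
    congr 1; push_cast; ring
  have e2 : XM ^ ((N : ℤ) + 2 - 2 * (j : ℤ)) = XM ^ 2 * XM ^ ((N : ℤ) - 2 * j) := by
    exact gen_zpow_add XM X0 _ _ (by ring)
  have e3 : XM ^ (2 * ((N + 1 - 1 - j : ℕ) : ℤ) - N) = XM ^ ((N : ℤ) - 2 * j) := by
    congr 1; omega
  have e4 : N + 1 - 1 - j = N - j := by omega
  rw [e1, e2, e3, e4]
  have key := congrArg (RatFunc.C : F →+* M) (T_coef N j (N - j) (by omega))
  simp only [map_mul, map_sub, map_one] at key ⊢
  linear_combination -(XM ^ ((N : ℤ) - 2 * j)) * key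

lemma gen_pi_pow {K L : Type} [Field K] [Field L] (C : K →+* L) (S : L →+* L) (w : K) (x : L)
    (hX : S x = C w * x⁻¹) (k : ℤ) : S (x ^ k) = C (w ^ k) * x ^ (-k) := by
  rw [map_zpow₀, hX, mul_zpow, map_zpow₀, inv_zpow, zpow_neg]

lemma pi_pow (S : M →+* M) (hX : S XM = RatFunc.C (u ^ 2) * XM⁻¹) (k : ℤ) :
    S (XM ^ k) = RatFunc.C ((u ^ 2) ^ k) * XM ^ (-k) :=
  gen_pi_pow RatFunc.C S _ _ hX k

lemma gen_inv_pow {L : Type} [Field L] (S : L →+* L) (x : L)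
    (hX : S x = x⁻¹) (k : ℤ) : S (x ^ k) = x ^ (-k) := by
  rw [map_zpow₀, hX, inv_zpow, zpow_neg]

lemma inv_pow' (S : M →+* M) (hX : S XM = XM⁻¹) (k : ℤ) :
    S (XM ^ k) = XM ^ (-k) := gen_inv_pow S _ hX k

lemma gen_X_inv_mul {L : Type} [Field L] (x : L) (hx : x ≠ 0) (k : ℤ) (c : L) :
    x⁻¹ * (c * x ^ k) = c * x ^ (k - 1) := by
  rw [zpow_sub_one₀ hx]; ring

lemma X_inv_mul (k : ℤ) (c : M) : XM⁻¹ * (c * XM ^ k) = c * XM ^ (k - 1) :=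
  gen_X_inv_mul XM XM_ne k c

lemma gen_cancel {L : Type} [Field L] (x : L) (hx : x ≠ 0) (c : L) :
    c = x * (x⁻¹ * c) := by
  rw [mul_inv_cancel_left₀ hx]

lemma q_eq (k : ℤ) : (u ^ 2) ^ (2 * k) = q ^ k := by
  rw [q, ← zpow_natCast u 2, ← zpow_natCast u 4, ← zpow_mul, ← zpow_mul]
  congr 1; push_cast; ring

lemma neg_star (N : ℕ) : starM (E (-(N : ℤ))) = XM⁻¹ * E ((N : ℤ) + 1) := by
  obtain ⟨σ, hu, hv, S, hS, hX, hC⟩ := star_hom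
  rw [← hS, E_neg_eq, E_pos_eq, map_sum, Finset.mul_sum]
  apply Finset.sum_congr rfl
  intro j hj
  have hj' : j < N + 1 := Finset.mem_range.1 hj
  rw [map_mul, hC, inv_pow' S hX, X_inv_mul, P_conj σ hu hv N j (by omega)]
  congr 2; ring

lemma pos_star (N : ℕ) : starM (E ((N : ℤ) + 1)) = XM⁻¹ * E (-(N : ℤ)) := by
  obtain ⟨σ, hu, hv, S, hS, hX, hC⟩ := star_hom
  rw [← hS, E_neg_eq, E_pos_eq, map_sum, Finset.mul_sum]
  apply Finset.sum_congr rfl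
  intro j hj
  have hj' : j < N + 1 := Finset.mem_range.1 hj
  have hq : σ q = q⁻¹ := by rw [q, map_pow, hu, inv_pow]
  rw [map_mul, hC, inv_pow' S hX, X_inv_mul, map_mul, P_conj σ hu hv N j (by omega), map_pow, hq,
    inv_pow, inv_mul_cancel_left₀ (pow_ne_zero _ q_ne)]
  congr 2; ring

lemma neg_pi (N : ℕ) :
    RatFunc.C ((u ^ 2) ^ (N : ℤ)) * piOp (E (-(N : ℤ))) = XM⁻¹ * E ((N : ℤ) + 1) := by
  obtain ⟨S, hS, hX, hC⟩ := pi_hom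
  rw [← hS, E_neg_eq, E_pos_eq, map_sum, Finset.mul_sum, Finset.mul_sum]
  apply Finset.sum_congr rfl
  intro j hj
  rw [map_mul, hC, pi_pow S hX, X_inv_mul, ← zpow_natCast q j, ← q_eq,
    show 2 * (j : ℤ) = N + (2 * j - N) by ring, zpow_add₀ (pow_ne_zero _ u_ne), map_mul, map_mul,
    show -((N : ℤ) + (2 * j - N) - N) = N + 1 - (N + (2 * j - N)) - 1 by ring]
  ring_nf

lemma pos_pi (N : ℕ) :
    RatFunc.C ((u ^ 2) ^ (-((N : ℤ) + 1))) * piOp (E ((N : ℤ) + 1)) = XM⁻¹ * E (-(N : ℤ)) := by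
  obtain ⟨S, hS, hX, hC⟩ := pi_hom
  rw [← hS, E_neg_eq, E_pos_eq, map_sum, Finset.mul_sum, Finset.mul_sum]
  apply Finset.sum_congr rfl
  intro j hj
  have h : (u ^ 2) ^ (-((N : ℤ) + 1)) * (q ^ j * macProdNeg N j) * (u ^ 2) ^ ((N : ℤ) + 1 - 2 * j)
      = macProdNeg N j := by
    rw [← zpow_natCast q j, ← q_eq]
    have hw : u ^ 2 ≠ 0 := pow_ne_zero _ u_ne
    have e : (u ^ 2) ^ (-((N : ℤ) + 1)) * (u ^ 2) ^ (2 * (j : ℤ)) *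
        (u ^ 2) ^ ((N : ℤ) + 1 - 2 * j) = 1 := by
      rw [← zpow_add₀ hw, ← zpow_add₀ hw]
      rw [show -((N : ℤ) + 1) + 2 * (j : ℤ) + ((N : ℤ) + 1 - 2 * j) = 0 by ring, zpow_zero]
    linear_combination macProdNeg N j * e
  rw [map_mul, hC, pi_pow S hX, X_inv_mul]
  conv_rhs => rw [← h]
  simp only [map_mul]
  rw [show -((N : ℤ) + 1 - 2 * j) = 2 * (j : ℤ) - N - 1 by ring]
  ring

lemma gen_T {L : Type} [Field L] (A B C1 D w x : L) (hw : w ≠ 0) (X0 : x ≠ 0)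
    (X1 : x ^ 2 - 1 ≠ 0) (key : (x ^ 2 - 1) * (C1 - B) = (1 - (w ^ 2)⁻¹) * (B - A))
    (key2 : (x⁻¹ ^ 2 - 1) * (D - A) = (1 - (w ^ 2)⁻¹) * (A - B)) :
    w⁻¹ * (w * B + (w - w⁻¹) * (B - A) / (x ^ 2 - 1)) = x⁻¹ * (x * C1) ∧
    w * (w * (x⁻¹ * D) + (w - w⁻¹) * (x⁻¹ * D - x * C1) / (x ^ 2 - 1)) = x⁻¹ * A := by
  have hx' : (x⁻¹ ^ 2 - 1) = -(x ^ 2 - 1) / x ^ 2 := by field_simp; ring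
  have key3 : (x ^ 2 - 1) * (D - A) = - x ^ 2 * ((1 - (w ^ 2)⁻¹) * (A - B)) := by
    rw [← key2, hx']; field_simp
  constructor
  · apply mul_left_cancel₀ X1
    field_simp at key ⊢
    linear_combination -key
  · apply mul_left_cancel₀ X1
    field_simp at key key3 ⊢
    have k4 : D - A = x ^ 2 * (C1 - B) := by
      apply mul_left_cancel₀ (mul_ne_zero X1 (pow_ne_zero 2 hw))
      linear_combination key3 - x ^ 2 * key
    linear_combination key3 + (w ^ 2 - 1) * k4

lemma neg_T (N : ℕ) :
    RatFunc.C v⁻¹ * TOp (E (-(N : ℤ))) = XM⁻¹ * E ((N : ℤ) + 1) ∧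
    RatFunc.C v * TOp (E ((N : ℤ) + 1)) = XM⁻¹ * E (-(N : ℤ)) := by
  obtain ⟨S, hS, hX, hC⟩ := s_hom
  have key := T_key N
  have X0 := XM_ne
  have X1 := sub_one_ne
  set C1 := ∑ j ∈ Finset.range (N + 1),
    RatFunc.C (q ^ j * macProdNeg N j) * XM ^ ((N : ℤ) - 2 * j) with hC1
  set B := ∑ j ∈ Finset.range (N + 1),
    RatFunc.C (macProdNeg N j) * XM ^ ((N : ℤ) - 2 * j) with hB
  set A := ∑ j ∈ Finset.range (N + 1),
    RatFunc.C (macProdNeg N j) * XM ^ (2 * (j : ℤ) - N) with hA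
  have hEn : E (-(N : ℤ)) = A := E_neg_eq N
  have hEp : E ((N : ℤ) + 1) = XM * C1 := by
    have : XM⁻¹ * E ((N : ℤ) + 1) = C1 := by
      rw [E_pos_eq, Finset.mul_sum, hC1]
      apply Finset.sum_congr rfl
      intro j hj
      rw [X_inv_mul]
      congr 2; ring
    rw [← this]
    exact gen_cancel XM X0 _
  have hSA : S A = B := by
    rw [hA, hB, map_sum]
    apply Finset.sum_congr rfl
    intro j hj
    rw [map_mul, hC, inv_pow' S hX]
    congr 2; ring
  have hSB : S B = A := by
    rw [hA, hB, map_sum]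
    apply Finset.sum_congr rfl
    intro j hj
    rw [map_mul, hC, inv_pow' S hX]
    congr 2; ring
  have key2 := congrArg S key
  simp only [map_mul, map_sub, map_pow, map_one, hC, hX, hSA, hSB] at key2
  rw [hEn, hEp, TOp, TOp, ← hS, ← hS, map_mul, hX, hSA]
  clear_value A B C1
  generalize S C1 = D at *
  have hw : (RatFunc.C v : M) ≠ 0 := by simpa using v_ne
  have ht : (RatFunc.C t⁻¹ : M) = (RatFunc.C v ^ 2)⁻¹ := by rw [map_inv₀, t, map_pow]
  simp only [map_sub, map_one, map_inv₀] at *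
  rw [ht] at key key2
  exact gen_T _ _ _ _ _ _ hw X0 X1 key key2

/-- Conjugation formula for the nonsymmetric Macdonald polynomials: for every `m ∈ ℤ`,
`(E_m)* = X⁻¹·E_{1-m} = q^{-m/2}·π(E_m)`, and moreover `(E_m)* = t^{1/2}·T(E_m)` if `m > 0`
and `(E_m)* = t^{-1/2}·T(E_m)` if `m ≤ 0` (the convention being `sgn 0 = -1`). -/
theorem macdonald_conjugation (m : ℤ) :
    starM (E m) = XM⁻¹ * E (1 - m) ∧
    starM (E m) = RatFunc.C ((u ^ 2) ^ (-m)) * piOp (E m) ∧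
    starM (E m) = RatFunc.C (if 0 < m then v else v⁻¹) * TOp (E m) := by
  rcases lt_or_ge 0 m with hm | hm
  · obtain ⟨N, rfl⟩ : ∃ N : ℕ, m = (N : ℤ) + 1 := ⟨(m - 1).toNat, by omega⟩
    have e : 1 - ((N : ℤ) + 1) = -(N : ℤ) := by ring
    rw [if_pos hm, e, (neg_T N).2, pos_pi, pos_star]
    exact ⟨rfl, rfl, rfl⟩
  · obtain ⟨N, rfl⟩ : ∃ N : ℕ, m = -(N : ℤ) := ⟨(-m).toNat, by omega⟩
    have e : 1 - -(N : ℤ) = (N : ℤ) + 1 := by ring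
    rw [if_neg (not_lt.2 hm), e, (neg_T N).1, neg_neg, neg_pi, neg_star]
    exact ⟨rfl, rfl, rfl⟩
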